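/- arXiv:2411.02474 — 2 statements merged into one kernel-verified Lean document; each statement's English description precedes it below -/
import Mathlib

section
/- Let G and H be groups and let s be a real number with 1/2 < s ≤ 1. Suppose G admits an invariant mean, and suppose there exist constants c ≥ 1 and ε₀ > 0 such that for every complex Hilbert space ℋ and every map f : H → U(ℋ) with f(1) = 1 and δ(f) ≤ ε for some ε ≤ ε₀, there exists a group homomorphism ρ : H → U(ℋ) with sup_{x∈H} ‖f(x) − ρ(x)‖ ≤ c·ε^s. Then there exist constants C > 0 and ε₁ > 0 such that for every complex Hilbert space ℋ and every map f : G×H → U(ℋ) with f(1,1) = 1 and δ(f) ≤ ε for some ε ≤ ε₁, there exists a group homomorphism ρ : G×H → U(ℋ) with sup_{(x,y)∈G×H} ‖f(x,y) − ρ(x,y)‖ ≤ C·ε^s. In particular, G×H is strongly Ulam stable with modulus O(ε^s). -/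
/-- A real-valued function is bounded. -/
def IsBddR {X : Type*} (φ : X → ℝ) : Prop := ∃ C, ∀ x, |φ x| ≤ C

/-- A mean on a set `X`: a positive normalized linear functional on the
bounded real-valued functions on `X`. -/
structure Mean (X : Type*) where
  app : (X → ℝ) → ℝ
  app_add : ∀ φ ψ : X → ℝ, IsBddR φ → IsBddR ψ →
    app (fun x => φ x + ψ x) = app φ + app ψ
  app_smul : ∀ (r : ℝ) (φ : X → ℝ), IsBddR φ →
    app (fun x => r * φ x) = r * app φ
  app_nonneg : ∀ φ : X → ℝ, IsBddR φ → (∀ x, 0 ≤ φ x) → 0 ≤ app φ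
  app_one : app (fun _ => 1) = 1

/-- An invariant mean on a group `G`: a mean invariant under left and right
translations. A group admitting an invariant mean is amenable. -/
structure InvariantMean (G : Type*) [Group G] extends Mean G where
  app_left : ∀ (g : G) (φ : G → ℝ), IsBddR φ → app (fun x => φ (g * x)) = app φ
  app_right : ∀ (g : G) (φ : G → ℝ), IsBddR φ → app (fun x => φ (x * g)) = app φ

universe u

open Filter Topology ComplexConjugate

namespace Mean

variable {X : Type*} (m : Mean X)

theorem app_const (r : ℝ) : m.app (fun _ => r) = r := by
  have h := m.app_smul r (fun _ => 1) ⟨1, by simp⟩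
  simpa [m.app_one] using h

theorem app_mono {φ ψ : X → ℝ} (hφ : IsBddR φ) (hψ : IsBddR ψ) (h : ∀ x, φ x ≤ ψ x) :
    m.app φ ≤ m.app ψ := by
  have hn : IsBddR (fun x => (-1) * φ x) := by
    obtain ⟨C, hC⟩ := hφ
    exact ⟨C, fun x => by simpa using hC x⟩
  have hd : IsBddR (fun x => ψ x + (-1) * φ x) := by
    obtain ⟨C, hC⟩ := hn
    obtain ⟨D, hD⟩ := hψ
    exact ⟨D + C, fun x => (abs_add_le _ _).trans (add_le_add (hD x) (hC x))⟩
  have h0 := m.app_nonneg _ hd (fun x => by linarith [h x])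
  rw [m.app_add _ _ hψ hn, m.app_smul _ _ hφ] at h0
  linarith

theorem app_le_of_le {φ : X → ℝ} {C : ℝ} (hφ : IsBddR φ) (h : ∀ x, φ x ≤ C) :
    m.app φ ≤ C := by
  simpa [m.app_const] using m.app_mono hφ ⟨|C|, fun _ => le_rfl⟩ h

/-- The complex-linear extension of a mean. -/
noncomputable def capp (φ : X → ℂ) : ℂ :=
  ⟨m.app (fun x => (φ x).re), m.app (fun x => (φ x).im)⟩

variable {m}

theorem isBddR_re {φ : X → ℂ} {C : ℝ} (h : ∀ x, ‖φ x‖ ≤ C) : IsBddR (fun x => (φ x).re) :=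
  ⟨C, fun x => (Complex.abs_re_le_norm _).trans (h x)⟩

theorem isBddR_im {φ : X → ℂ} {C : ℝ} (h : ∀ x, ‖φ x‖ ≤ C) : IsBddR (fun x => (φ x).im) :=
  ⟨C, fun x => (Complex.abs_im_le_norm _).trans (h x)⟩

theorem capp_add {φ ψ : X → ℂ} {C D : ℝ} (hφ : ∀ x, ‖φ x‖ ≤ C) (hψ : ∀ x, ‖ψ x‖ ≤ D) :
    m.capp (fun x => φ x + ψ x) = m.capp φ + m.capp ψ := by
  apply Complex.ext
  · exact m.app_add _ _ (isBddR_re hφ) (isBddR_re hψ)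
  · exact m.app_add _ _ (isBddR_im hφ) (isBddR_im hψ)

theorem capp_mul {φ : X → ℂ} {C : ℝ} (c : ℂ) (hφ : ∀ x, ‖φ x‖ ≤ C) :
    m.capp (fun x => c * φ x) = c * m.capp φ := by
  have bdd : ∀ {ψ : X → ℝ} (r : ℝ), IsBddR ψ → IsBddR (fun x => r * ψ x) := by
    rintro ψ r ⟨D, hD⟩
    exact ⟨|r| * D, fun x => by
      rw [abs_mul]; exact mul_le_mul_of_nonneg_left (hD x) (abs_nonneg r)⟩
  have hre := isBddR_re hφ
  have him := isBddR_im hφ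
  apply Complex.ext
  · have h := m.app_add _ _ (bdd c.re hre) (bdd (-c.im) him)
    rw [m.app_smul _ _ hre, m.app_smul _ _ him] at h
    simpa [capp, sub_eq_add_neg] using h
  · have h := m.app_add _ _ (bdd c.re him) (bdd c.im hre)
    rw [m.app_smul _ _ hre, m.app_smul _ _ him] at h
    simpa [capp] using h

theorem capp_const (c : ℂ) : m.capp (fun _ => c) = c :=
  Complex.ext (m.app_const _) (m.app_const _)

theorem capp_conj {φ : X → ℂ} {C : ℝ} (hφ : ∀ x, ‖φ x‖ ≤ C) :
    m.capp (fun x => conj (φ x)) = conj (m.capp φ) := by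
  apply Complex.ext
  · simp [capp]
  · simpa [capp] using m.app_smul (-1) _ (isBddR_im hφ)

theorem norm_capp_le {φ : X → ℂ} {C : ℝ} (hφ : ∀ x, ‖φ x‖ ≤ C) : ‖m.capp φ‖ ≤ C := by
  set z := m.capp φ with hz
  by_contra! hlt
  have hX : Nonempty X := by
    by_contra hX
    rw [not_nonempty_iff] at hX
    have h1 := m.app_one
    have h2 := m.app_const 0
    rw [show (fun _ : X => (1 : ℝ)) = fun _ => 0 from funext fun x => isEmptyElim x] at h1
    linarith
  have hC : 0 ≤ C := (norm_nonneg _).trans (hφ hX.some)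
  have hb : ∀ x, ‖conj z * φ x‖ ≤ ‖z‖ * C := fun x => by
    rw [norm_mul, RCLike.norm_conj]
    exact mul_le_mul_of_nonneg_left (hφ x) (norm_nonneg _)
  have h1 : (m.capp (fun x => conj z * φ x)).re ≤ ‖z‖ * C :=
    m.app_le_of_le (isBddR_re hb) fun x => (Complex.re_le_norm _).trans (hb x)
  rw [capp_mul _ hφ, ← hz, ← Complex.normSq_eq_conj_mul_self, Complex.ofReal_re,
    Complex.normSq_eq_norm_sq] at h1
  nlinarith

end Mean

section OperatorMean

variable {X : Type*} {m : Mean X} {ℋ : Type*} [NormedAddCommGroup ℋ] [InnerProductSpace ℂ ℋ]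

/-- `T` is the weak average of the operator-valued function `F` with respect to the mean `m`. -/
def HasOpMean (m : Mean X) (F : X → ℋ →L[ℂ] ℋ) (T : ℋ →L[ℂ] ℋ) : Prop :=
  ∀ ξ η : ℋ, inner ℂ ξ (T η) = m.capp (fun x => inner ℂ ξ (F x η))

theorem norm_inner_apply_le {F : X → ℋ →L[ℂ] ℋ} {C : ℝ} (hF : ∀ x, ‖F x‖ ≤ C) (ξ η : ℋ)
    (x : X) : ‖inner ℂ ξ (F x η)‖ ≤ C * ‖ξ‖ * ‖η‖ := by
  calc ‖inner ℂ ξ (F x η)‖ ≤ ‖ξ‖ * ‖F x η‖ := norm_inner_le_norm _ _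
    _ ≤ ‖ξ‖ * (C * ‖η‖) := by gcongr; exact (F x).le_of_opNorm_le (hF x) η
    _ = C * ‖ξ‖ * ‖η‖ := by ring

theorem exists_hasOpMean [CompleteSpace ℋ] (m : Mean X) {F : X → ℋ →L[ℂ] ℋ} {C : ℝ}
    (hF : ∀ x, ‖F x‖ ≤ C) :
    ∃ T, HasOpMean m F T := by
  let B : ℋ →ₗ⋆[ℂ] ℋ →ₗ[ℂ] ℂ := LinearMap.mk₂'ₛₗ (starRingEnd ℂ) (RingHom.id ℂ)
    (fun ξ η => m.capp (fun x => inner ℂ ξ (F x η)))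
    (fun ξ ξ' η => by
      simp only [inner_add_left]
      exact Mean.capp_add (norm_inner_apply_le hF _ _) (norm_inner_apply_le hF _ _))
    (fun c ξ η => by
      simp only [inner_smul_left]
      exact Mean.capp_mul _ (norm_inner_apply_le hF _ _))
    (fun ξ η η' => by
      simp only [map_add, inner_add_right]
      exact Mean.capp_add (norm_inner_apply_le hF _ _) (norm_inner_apply_le hF _ _))
    (fun c ξ η => by
      simp only [map_smul, inner_smul_right]
      exact Mean.capp_mul _ (norm_inner_apply_le hF _ _))
  let B' := B.mkContinuous₂ C fun ξ η => Mean.norm_capp_le (norm_inner_apply_le hF ξ η)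
  refine ⟨ContinuousLinearMap.adjoint (InnerProductSpace.continuousLinearMapOfBilin B'),
    fun ξ η => ?_⟩
  rw [ContinuousLinearMap.adjoint_inner_right, InnerProductSpace.continuousLinearMapOfBilin_apply]
  rfl

namespace HasOpMean

variable {F F' : X → ℋ →L[ℂ] ℋ} {T T' : ℋ →L[ℂ] ℋ} {C C' : ℝ}

theorem unique (h : HasOpMean m F T) (h' : HasOpMean m F T') : T = T' :=
  ContinuousLinearMap.ext fun η => ext_inner_left ℂ fun ξ => by rw [h, h']

theorem const (T : ℋ →L[ℂ] ℋ) : HasOpMean m (fun _ : X => T) T :=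
  fun _ _ => (Mean.capp_const _).symm

theorem norm_le (h : HasOpMean m F T) (hF : ∀ x, ‖F x‖ ≤ C) (hC : 0 ≤ C) : ‖T‖ ≤ C := by
  refine T.opNorm_le_bound hC fun η => ?_
  have h1 : ‖inner ℂ (T η) (T η)‖ ≤ C * ‖T η‖ * ‖η‖ := by
    rw [h]
    exact Mean.norm_capp_le (norm_inner_apply_le hF _ _)
  rw [inner_self_eq_norm_sq_to_K, norm_pow, RCLike.norm_ofReal, abs_norm] at h1
  by_contra! hlt
  nlinarith [norm_nonneg (T η), norm_nonneg η, mul_nonneg hC (norm_nonneg η)]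

theorem add (h : HasOpMean m F T) (h' : HasOpMean m F' T')
    (hF : ∀ x, ‖F x‖ ≤ C) (hF' : ∀ x, ‖F' x‖ ≤ C') :
    HasOpMean m (fun x => F x + F' x) (T + T') := fun ξ η => by
  simp only [add_apply, inner_add_right]
  rw [h, h', Mean.capp_add (norm_inner_apply_le hF _ _) (norm_inner_apply_le hF' _ _)]

theorem neg (h : HasOpMean m F T) (hF : ∀ x, ‖F x‖ ≤ C) :
    HasOpMean m (fun x => -F x) (-T) := fun ξ η => by
  have := Mean.capp_mul (m := m) (-1) (norm_inner_apply_le hF ξ η)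
  simpa [inner_neg_right, h ξ η] using this.symm

theorem sub (h : HasOpMean m F T) (h' : HasOpMean m F' T')
    (hF : ∀ x, ‖F x‖ ≤ C) (hF' : ∀ x, ‖F' x‖ ≤ C') :
    HasOpMean m (fun x => F x - F' x) (T - T') := by
  simpa only [sub_eq_add_neg] using h.add (h'.neg hF') hF
    (fun x => (norm_neg (F' x)).trans_le (hF' x))

theorem mul_const (h : HasOpMean m F T) (S : ℋ →L[ℂ] ℋ) :
    HasOpMean m (fun x => F x * S) (T * S) :=
  fun ξ η => h ξ (S η)

variable [CompleteSpace ℋ]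

theorem const_mul (h : HasOpMean m F T) (S : ℋ →L[ℂ] ℋ) :
    HasOpMean m (fun x => S * F x) (S * T) := fun ξ η => by
  have := h (ContinuousLinearMap.adjoint S ξ) η
  simp only [ContinuousLinearMap.adjoint_inner_left] at this
  exact this

theorem star (h : HasOpMean m F T) (hF : ∀ x, ‖F x‖ ≤ C) :
    HasOpMean m (fun x => star (F x)) (star T) := fun ξ η => by
  have h1 := Mean.capp_conj (m := m) (norm_inner_apply_le hF η ξ)
  rw [← h] at h1
  simpa only [ContinuousLinearMap.star_eq_adjoint, ContinuousLinearMap.adjoint_inner_right,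
    inner_conj_symm] using h1.symm

/-- The average of a product differs from the product of the averages by a quantity that is
quadratic in the oscillation. -/
theorem norm_mul_sub_le (h : HasOpMean m F T) (h' : HasOpMean m F' T') {W S S' : ℋ →L[ℂ] ℋ}
    (hW : HasOpMean m (fun x => F x * F' x) W) {r : ℝ} (hr : 0 ≤ r)
    (hF : ∀ x, ‖F x - S‖ ≤ r) (hF' : ∀ x, ‖F' x - S'‖ ≤ r) :
    ‖W - T * T'‖ ≤ 2 * r ^ 2 := by
  have bd : ∀ {E : X → ℋ →L[ℂ] ℋ} {R : ℋ →L[ℂ] ℋ}, (∀ x, ‖E x - R‖ ≤ r) →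
      ∀ x, ‖E x‖ ≤ r + ‖R‖ := fun {E R} hE x => by
    linarith [norm_sub_norm_le (E x) R, hE x]
  have bS : ∀ (R : ℋ →L[ℂ] ℋ) (_ : X), ‖R‖ ≤ ‖R‖ := fun _ _ => le_rfl
  have bmul : ∀ {E E' : X → ℋ →L[ℂ] ℋ} {D D' : ℝ}, (∀ x, ‖E x‖ ≤ D) → (∀ x, ‖E' x‖ ≤ D') →
      ∀ x, ‖E x * E' x‖ ≤ D * D' := fun {E E' D D'} hE hE' x =>
    (norm_mul_le _ _).trans (mul_le_mul (hE x) (hE' x) (norm_nonneg _)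
      ((norm_nonneg _).trans (hE x)))
  have hT : ‖T - S‖ ≤ r := (h.sub (const S) (bd hF) (bS S)).norm_le hF hr
  have hT' : ‖T' - S'‖ ≤ r := (h'.sub (const S') (bd hF') (bS S')).norm_le hF' hr
  have h1 := hW.sub (h'.const_mul S) (bmul (bd hF) (bd hF')) (bmul (bS S) (bd hF'))
  have h2 := (h.sub (const S) (bd hF) (bS S)).mul_const S'
  have h3 := h1.sub h2 (fun x => (norm_sub_le _ _).trans
      (add_le_add (bmul (bd hF) (bd hF') x) (bmul (bS S) (bd hF') x))) (bmul hF (bS S'))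
  have h4 : ‖W - S * T' - (T - S) * S'‖ ≤ r * r := by
    refine h3.norm_le (fun x => ?_) (by positivity)
    rw [show F x * F' x - S * F' x - (F x - S) * S' = (F x - S) * (F' x - S') by noncomm_ring]
    exact bmul hF hF' x
  calc ‖W - T * T'‖ = ‖(W - S * T' - (T - S) * S') - (T - S) * (T' - S')‖ := by
        congr 1; noncomm_ring
    _ ≤ r * r + r * r := (norm_sub_le _ _).trans (add_le_add h4
        ((norm_mul_le _ _).trans (mul_le_mul hT hT' (norm_nonneg _) hr)))
    _ = 2 * r ^ 2 := by ring

end HasOpMean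

end OperatorMean

section Unitary

variable {A : Type*} [CStarAlgebra A]

theorem norm_coe_unitary_le_one (u : unitary A) : ‖(u : A)‖ ≤ 1 := by
  nontriviality A
  exact (CStarRing.norm_coe_unitary u).le

theorem exists_unitary_norm_sub_le {T : A} (h : ‖star T * T - 1‖ < 1) (h' : ‖T * star T - 1‖ < 1) :
    ∃ u : unitary A, ‖(u : A) - T‖ ≤ ‖star T * T - 1‖ := by
  set a := star T * T with ha_def
  have ha : IsSelfAdjoint a := IsSelfAdjoint.star_mul_self T
  have hcfc : cfc (fun x : ℝ => x - 1) a = a - 1 := by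
    rw [cfc_sub (fun x : ℝ => x) (fun _ => 1) a, cfc_id' ℝ a, cfc_const_one ℝ a]
  have hspec : ∀ x ∈ spectrum ℝ a, |x - 1| ≤ ‖a - 1‖ := fun x hx => by
    have := norm_apply_le_norm_cfc (fun x : ℝ => x - 1) a hx
    rwa [hcfc] at this
  have hpos : ∀ x ∈ spectrum ℝ a, 0 < x := fun x hx => by
    have := abs_lt.1 ((hspec x hx).trans_lt h)
    linarith
  have hcont : ContinuousOn (fun x : ℝ => (√x)⁻¹) (spectrum ℝ a) :=
    Real.continuous_sqrt.continuousOn.inv₀ fun x hx => (Real.sqrt_pos.2 (hpos x hx)).ne'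
  set b := cfc Real.sqrt a with hb_def
  set c := cfc (fun x : ℝ => (√x)⁻¹) a with hc_def
  have hbb : b * b = a := by
    rw [hb_def, ← cfc_mul Real.sqrt Real.sqrt a]
    conv_rhs => rw [← cfc_id' ℝ a]
    exact cfc_congr fun x hx => Real.mul_self_sqrt (hpos x hx).le
  have hbc : b * c = 1 := by
    rw [hb_def, hc_def, ← cfc_mul Real.sqrt _ a Real.continuous_sqrt.continuousOn hcont,
      ← cfc_const_one ℝ a]
    exact cfc_congr fun x hx => mul_inv_cancel₀ (Real.sqrt_pos.2 (hpos x hx)).ne'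
  have hcb : c * b = 1 := by
    rw [← hbc]; exact cfc_commute_cfc _ _ a
  have hc : star c = c := cfc_predicate (fun x : ℝ => (√x)⁻¹) a
  have hTb : T * c * b = T := by rw [mul_assoc, hcb, mul_one]
  have huu : star (T * c) * (T * c) = 1 := by
    calc star (T * c) * (T * c) = c * (star T * T) * c := by rw [star_mul, hc]; noncomm_ring
      _ = c * b * (b * c) := by rw [← ha_def, ← hbb]; noncomm_ring
      _ = 1 := by rw [hcb, hbc, one_mul]
  have huu' : (T * c) * star (T * c) = 1 := by
    have hunit : IsUnit (T * star T) := by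
      have := isUnit_one_sub_of_norm_lt_one (x := 1 - T * star T) (by rwa [norm_sub_rev])
      simpa using this
    have hz : (T * c * star (T * c) - 1) * (T * star T) = 0 := by
      have : (T * c * star (T * c) - 1) * T = 0 := by
        nth_rewrite 3 [← hTb]
        calc (T * c * star (T * c) - 1) * (T * c * b)
            = T * c * (star (T * c) * (T * c)) * b - T * c * b := by noncomm_ring
          _ = 0 := by rw [huu]; simp
      rw [← mul_assoc, this, zero_mul]
    exact sub_eq_zero.1 ((hunit.mul_left_eq_zero).1 hz)
  let u : unitary A := ⟨T * c, Unitary.mem_iff.2 ⟨huu, huu'⟩⟩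
  refine ⟨u, ?_⟩
  have hu : (u : A) - T = u * (1 - b) := by
    rw [mul_sub, mul_one]; congr 1; exact hTb.symm
  have hb1 : 1 - b = cfc (fun x : ℝ => 1 - √x) a := by
    rw [cfc_sub (fun _ : ℝ => 1) Real.sqrt a, cfc_const_one ℝ a]
  rw [hu, CStarRing.norm_coe_unitary_mul, hb1]
  refine norm_cfc_le (norm_nonneg _) fun x hx => le_trans ?_ (hspec x hx)
  have hx0 := (hpos x hx).le
  have hs := Real.sqrt_nonneg x
  rw [Real.norm_eq_abs, show x - 1 = (√x - 1) * (√x + 1) by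
    ring_nf; rw [Real.sq_sqrt hx0], abs_mul, abs_sub_comm]
  refine le_mul_of_one_le_right (abs_nonneg _) ?_
  rw [abs_of_nonneg] <;> linarith

end Unitary

section Limit

variable {Γ A : Type*} [Group Γ] [CStarAlgebra A]

/-- If every almost homomorphism of small defect can be moved by `O(ε ^ s)` so as to halve its
defect, then it is `O(ε ^ s)`-close to a homomorphism. -/
theorem exists_monoidHom_of_halving {s ε₁ L : ℝ} (hs : 0 < s)
    (step : ∀ (f : Γ → unitary A) (ε : ℝ), ε ≤ ε₁ → f 1 = 1 →
      (∀ a b, ‖(f (a * b) : A) - f a * f b‖ ≤ ε) →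
      ∃ f' : Γ → unitary A, f' 1 = 1 ∧ (∀ a b, ‖(f' (a * b) : A) - f' a * f' b‖ ≤ ε / 2) ∧
        ∀ a, ‖(f a : A) - f' a‖ ≤ L * ε ^ s)
    (f : Γ → unitary A) (ε : ℝ) (hε : ε ≤ ε₁) (hf1 : f 1 = 1)
    (hf : ∀ a b, ‖(f (a * b) : A) - f a * f b‖ ≤ ε) :
    ∃ ρ : Γ →* unitary A, ∀ a, ‖(f a : A) - ρ a‖ ≤ L / (1 - (1 / 2) ^ s) * ε ^ s := by
  have hε0 : 0 ≤ ε := (norm_nonneg _).trans (hf 1 1)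
  let P : ℕ → (Γ → unitary A) → Prop := fun n g =>
    g 1 = 1 ∧ ∀ a b, ‖(g (a * b) : A) - g a * g b‖ ≤ ε / 2 ^ n
  have next : ∀ (n : ℕ) (g : {g // P n g}), ∃ g' : {g // P (n + 1) g},
      ∀ a, ‖(g.1 a : A) - g'.1 a‖ ≤ L * (ε / 2 ^ n) ^ s := by
    rintro n ⟨g, hg1, hg⟩
    obtain ⟨g', h1, h2, h3⟩ := step g (ε / 2 ^ n)
      ((div_le_self hε0 (one_le_pow₀ one_le_two)).trans hε) hg1 hg
    refine ⟨⟨g', h1, fun a b => (h2 a b).trans_eq ?_⟩, h3⟩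
    rw [pow_succ, div_div]
  choose nx hnx using next
  let F : ∀ n, {g // P n g} := fun n => Nat.rec ⟨f, hf1, by simpa using hf⟩ (fun n g => nx n g) n
  have hF : ∀ a n, dist ((F n).1 a : A) ((F (n + 1)).1 a) ≤ L * ε ^ s * ((1 / 2) ^ s) ^ n := by
    intro a n
    rw [dist_eq_norm]
    refine (hnx n (F n) a).trans_eq ?_
    rw [div_eq_mul_one_div, Real.mul_rpow hε0 (by positivity), ← Real.rpow_natCast (((1:ℝ)/2)^s),
      ← Real.rpow_mul (by norm_num), mul_comm s, Real.rpow_mul (by norm_num), Real.rpow_natCast,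
      one_div_pow, mul_assoc]
  have hq : ((1 : ℝ) / 2) ^ s < 1 := Real.rpow_lt_one (by norm_num) (by norm_num) hs
  choose ρ hρ using fun a => cauchySeq_tendsto_of_complete (cauchySeq_of_le_geometric _ _ hq (hF a))
  have hρu : ∀ a, ρ a ∈ unitary A := fun a =>
    isClosed_unitary.mem_of_tendsto (hρ a) (Eventually.of_forall fun n => ((F n).1 a).2)
  have hmul : ∀ a b, ρ (a * b) = ρ a * ρ b := fun a b => by
    have h1 := ((hρ (a * b)).sub ((hρ a).mul (hρ b))).norm
    have h2 : Tendsto (fun n : ℕ => ε / 2 ^ n) atTop (𝓝 0) :=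
      tendsto_const_nhds.div_atTop (tendsto_pow_atTop_atTop_of_one_lt one_lt_two)
    have h3 := le_of_tendsto_of_tendsto' h1 h2 fun n => (F n).2.2 a b
    exact sub_eq_zero.1 (norm_le_zero_iff.1 h3)
  refine ⟨MonoidHom.mk' (fun a => ⟨ρ a, hρu a⟩) fun a b => Subtype.ext (hmul a b), fun a => ?_⟩
  have := dist_le_of_le_geometric_of_tendsto₀ _ _ hq (hF a) (hρ a)
  rw [dist_eq_norm] at this
  refine this.trans_eq ?_
  ring

end Limit

section Averaging

variable {G Γ ℋ : Type*} [Group G] [Group Γ] [NormedAddCommGroup ℋ] [InnerProductSpace ℂ ℋ]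

theorem HasOpMean.shift {m : InvariantMean G} {F : G → ℋ →L[ℂ] ℋ} {T : ℋ →L[ℂ] ℋ} {C : ℝ}
    (h : HasOpMean m.toMean F T) (hF : ∀ x, ‖F x‖ ≤ C) (g : G) :
    HasOpMean m.toMean (fun x => F (g * x)) T := fun ξ η => by
  rw [h]
  have hb := norm_inner_apply_le hF ξ η
  exact Complex.ext (m.app_left g _ (Mean.isBddR_re hb)).symm
    (m.app_left g _ (Mean.isBddR_im hb)).symm

variable [CompleteSpace ℋ]

/-- Averaging a unitary cocycle over `G` which stays within `r` of `f`, and taking unitary parts,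
yields a map near `f` whose defect is quadratic in `r`. -/
theorem exists_unitary_map_of_cocycle (m : InvariantMean G) (σ : Γ → G)
    (A : Γ → G → unitary (ℋ →L[ℂ] ℋ)) (hA1 : ∀ x, A 1 x = 1)
    (hA : ∀ a b x, A (a * b) x = A a (σ b * x) * A b x)
    (f : Γ → unitary (ℋ →L[ℂ] ℋ)) {r : ℝ} (hr : 0 ≤ r) (hr1 : 2 * r ^ 2 < 1)
    (hf : ∀ a x, ‖(A a x : ℋ →L[ℂ] ℋ) - f a‖ ≤ r) :
    ∃ f' : Γ → unitary (ℋ →L[ℂ] ℋ), f' 1 = 1 ∧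
      (∀ a b, ‖(f' (a * b) : ℋ →L[ℂ] ℋ) - f' a * f' b‖ ≤ 8 * r ^ 2) ∧
      ∀ a, ‖(f a : ℋ →L[ℂ] ℋ) - f' a‖ ≤ r + 2 * r ^ 2 := by
  have hAb : ∀ a x, ‖(A a x : ℋ →L[ℂ] ℋ)‖ ≤ 1 := fun a x => norm_coe_unitary_le_one _
  choose S hS using fun a => exists_hasOpMean m.toMean (hAb a)
  have hS1 : S 1 = 1 := by
    refine (hS 1).unique ?_
    simp only [hA1]
    exact HasOpMean.const _
  have hSb : ∀ a, ‖S a‖ ≤ 1 := fun a => (hS a).norm_le (hAb a) zero_le_one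
  have hSf : ∀ a, ‖S a - f a‖ ≤ r := fun a =>
    ((hS a).sub (HasOpMean.const (f a : ℋ →L[ℂ] ℋ)) (hAb a) (fun _ => le_rfl)).norm_le (hf a) hr
  have hfs : ∀ a x, ‖star (A a x : ℋ →L[ℂ] ℋ) - star (f a : ℋ →L[ℂ] ℋ)‖ ≤ r := fun a x => by
    rw [← star_sub, norm_star]; exact hf a x
  have hSS : ∀ a, ‖star (S a) * S a - 1‖ ≤ 2 * r ^ 2 := fun a => by
    rw [norm_sub_rev]
    refine ((hS a).star (hAb a)).norm_mul_sub_le (hS a) ?_ hr (hfs a) (hf a)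
    simpa only [Unitary.coe_star_mul_self] using HasOpMean.const (1 : ℋ →L[ℂ] ℋ)
  have hSS' : ∀ a, ‖S a * star (S a) - 1‖ ≤ 2 * r ^ 2 := fun a => by
    rw [norm_sub_rev]
    refine (hS a).norm_mul_sub_le ((hS a).star (hAb a)) ?_ hr (hf a) (hfs a)
    simp only [Unitary.mul_star_self_of_mem (A a _).2]
    exact HasOpMean.const _
  have hSmul : ∀ a b, ‖S (a * b) - S a * S b‖ ≤ 2 * r ^ 2 := fun a b => by
    refine ((hS a).shift (hAb a) (σ b)).norm_mul_sub_le (hS b) ?_ hr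
      (fun x => hf a _) (hf b)
    have := hS (a * b)
    simpa only [hA, Submonoid.coe_mul] using this
  choose u hu using fun a => exists_unitary_norm_sub_le ((hSS a).trans_lt hr1)
    ((hSS' a).trans_lt hr1)
  have huS : ∀ a, ‖(u a : ℋ →L[ℂ] ℋ) - S a‖ ≤ 2 * r ^ 2 := fun a => (hu a).trans (hSS a)
  refine ⟨u, ?_, fun a b => ?_, fun a => ?_⟩
  · have h := hu 1
    simp only [hS1, star_one, mul_one, sub_self, norm_zero] at h
    exact Subtype.ext (sub_eq_zero.1 (norm_le_zero_iff.1 h))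
  · have e1 : ‖(u a : ℋ →L[ℂ] ℋ) * (S b - u b)‖ ≤ 2 * r ^ 2 := by
      rw [CStarRing.norm_coe_unitary_mul, norm_sub_rev]; exact huS b
    have e2 : ‖(S a - u a) * S b‖ ≤ 2 * r ^ 2 := by
      refine (norm_mul_le _ _).trans ?_
      rw [norm_sub_rev]
      exact (mul_le_of_le_one_right (norm_nonneg _) (hSb b)).trans (huS a)
    calc ‖(u (a * b) : ℋ →L[ℂ] ℋ) - u a * u b‖
        = ‖((u (a * b) : ℋ →L[ℂ] ℋ) - S (a * b)) + (S (a * b) - S a * S b)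
            + (S a - u a) * S b + u a * (S b - u b)‖ := by congr 1; noncomm_ring
      _ ≤ 2 * r ^ 2 + 2 * r ^ 2 + 2 * r ^ 2 + 2 * r ^ 2 :=
          norm_add_le_of_le (norm_add_le_of_le (norm_add_le_of_le (huS _) (hSmul a b)) e2) e1
      _ = 8 * r ^ 2 := by ring
  · calc ‖(f a : ℋ →L[ℂ] ℋ) - u a‖ = ‖(S a - f a) + (u a - S a)‖ := by
          rw [norm_sub_rev]; congr 1; abel
      _ ≤ r + 2 * r ^ 2 := norm_add_le_of_le (hSf a) (huS a)

end Averaging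

section Product

variable {G H ℋ : Type*} [Group G] [Group H] [NormedAddCommGroup ℋ] [InnerProductSpace ℂ ℋ]
  [CompleteSpace ℋ]

/-- An almost homomorphism on `G × H` whose restriction to `H` is near a homomorphism can be
corrected so that the new defect is quadratic. -/
theorem exists_quadratic_correction (m : InvariantMean G)
    (f : G × H → unitary (ℋ →L[ℂ] ℋ)) {ε d : ℝ}
    (hf : ∀ a b, ‖(f (a * b) : ℋ →L[ℂ] ℋ) - f a * f b‖ ≤ ε)
    (ρ : H →* unitary (ℋ →L[ℂ] ℋ)) (hρ : ∀ y, ‖(f (1, y) : ℋ →L[ℂ] ℋ) - ρ y‖ ≤ d)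
    (hr1 : 2 * (d + 2 * ε) ^ 2 < 1) :
    ∃ f' : G × H → unitary (ℋ →L[ℂ] ℋ), f' 1 = 1 ∧
      (∀ a b, ‖(f' (a * b) : ℋ →L[ℂ] ℋ) - f' a * f' b‖ ≤ 8 * (d + 2 * ε) ^ 2) ∧
      ∀ a, ‖(f a : ℋ →L[ℂ] ℋ) - f' a‖ ≤ (d + 2 * ε) + 2 * (d + 2 * ε) ^ 2 := by
  have hε : 0 ≤ ε := (norm_nonneg _).trans (hf 1 1)
  have hd : 0 ≤ d := (norm_nonneg _).trans (hρ 1)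
  refine exists_unitary_map_of_cocycle m Prod.fst
    (fun a x => f (a.1 * x, 1) * ρ a.2 * star (f (x, 1))) (fun x => ?_) (fun a b x => ?_) f
    (by positivity) hr1 (fun a x => ?_)
  · simp
  · simp only [Prod.fst_mul, Prod.snd_mul, map_mul, mul_assoc]
    rw [← mul_assoc (star (f (b.1 * x, 1))), Unitary.star_mul_self, one_mul]
  · obtain ⟨g, y⟩ := a
    have h1 := hf (g * x, 1) (1, y)
    have h2 := hf (g, y) (x, 1)
    simp only [Prod.mk_mul_mk, mul_one, one_mul] at h1 h2
    have h3 : ‖(f (g * x, 1) : ℋ →L[ℂ] ℋ) * (f (1, y) - ρ y)‖ ≤ d := by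
      rw [CStarRing.norm_coe_unitary_mul]; exact hρ y
    rw [norm_sub_rev] at h1
    have key : ‖(f (g * x, 1) : ℋ →L[ℂ] ℋ) * ρ y - f (g, y) * f (x, 1)‖ ≤ d + 2 * ε := by
      calc ‖(f (g * x, 1) : ℋ →L[ℂ] ℋ) * ρ y - f (g, y) * f (x, 1)‖
          = ‖(f (g * x, y) - f (g, y) * f (x, 1))
              + (f (g * x, 1) * f (1, y) - f (g * x, y))
              - f (g * x, 1) * (f (1, y) - ρ y : ℋ →L[ℂ] ℋ)‖ := by congr 1; noncomm_ring
        _ ≤ ε + ε + d := norm_sub_le_of_le (norm_add_le_of_le h2 h1) h3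
        _ = d + 2 * ε := by ring
    rw [← CStarRing.norm_mul_coe_unitary _ (f (x, 1))]
    refine le_of_eq_of_le ?_ key
    congr 1
    push_cast
    rw [sub_mul, mul_assoc _ (star _), Unitary.coe_star_mul_self, mul_one]

end Product

/-- If `G` admits an invariant mean (is amenable) and `H` is
strongly Ulam stable with modulus `O(ε^s)` for some `1/2 < s ≤ 1`, then `G × H`
is strongly Ulam stable with modulus `O(ε^s)`. Here `ε ^ s` is the real power. -/
theorem product_preservation_holder (G H : Type*) [Group G] [Group H] (s : ℝ)
    (hs : 1 / 2 < s) (hs1 : s ≤ 1)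
    (m : InvariantMean G) (c ε₀ : ℝ) (hc : 1 ≤ c) (hε₀ : 0 < ε₀)
    (hH : ∀ (ℋ : Type u) [NormedAddCommGroup ℋ] [InnerProductSpace ℂ ℋ] [CompleteSpace ℋ]
      (f : H → unitary (ℋ →L[ℂ] ℋ)) (ε : ℝ), ε ≤ ε₀ → f 1 = 1 →
      (∀ x y : H,
        ‖(f (x * y) : ℋ →L[ℂ] ℋ) - (f x : ℋ →L[ℂ] ℋ) * (f y : ℋ →L[ℂ] ℋ)‖ ≤ ε) →
      ∃ ρ : H →* unitary (ℋ →L[ℂ] ℋ),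
        ∀ x : H, ‖(f x : ℋ →L[ℂ] ℋ) - (ρ x : ℋ →L[ℂ] ℋ)‖ ≤ c * ε ^ s) :
    ∃ C ε₁ : ℝ, 0 < C ∧ 0 < ε₁ ∧
      ∀ (ℋ : Type u) [NormedAddCommGroup ℋ] [InnerProductSpace ℂ ℋ] [CompleteSpace ℋ]
        (f : G × H → unitary (ℋ →L[ℂ] ℋ)) (ε : ℝ), ε ≤ ε₁ → f 1 = 1 →
        (∀ a b : G × H,
          ‖(f (a * b) : ℋ →L[ℂ] ℋ) - (f a : ℋ →L[ℂ] ℋ) * (f b : ℋ →L[ℂ] ℋ)‖ ≤ ε) →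
        ∃ ρ : G × H →* unitary (ℋ →L[ℂ] ℋ),
          ∀ a : G × H, ‖(f a : ℋ →L[ℂ] ℋ) - (ρ a : ℋ →L[ℂ] ℋ)‖ ≤ C * ε ^ s := by
  have ht : 0 < 2 * s - 1 := by linarith
  set k := c + 2 with hk
  have hk0 : 0 < k := by linarith
  obtain ⟨ε₂, hε₂, hsmall⟩ : ∃ ε₂ : ℝ, 0 < ε₂ ∧
      ∀ ε : ℝ, 0 ≤ ε → ε ≤ ε₂ → ε ^ (2 * s - 1) ≤ 1 / (16 * k ^ 2) := by
    refine ⟨(1 / (16 * k ^ 2)) ^ (2 * s - 1)⁻¹, by positivity, fun ε h0 h => ?_⟩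
    calc ε ^ (2 * s - 1) ≤ ((1 / (16 * k ^ 2)) ^ (2 * s - 1)⁻¹) ^ (2 * s - 1) :=
          Real.rpow_le_rpow h0 h ht.le
      _ = 1 / (16 * k ^ 2) := Real.rpow_inv_rpow (by positivity) ht.ne'
  have hq : ((1 : ℝ) / 2) ^ s < 1 := Real.rpow_lt_one (by norm_num) (by norm_num) (by linarith)
  refine ⟨(k + 2 * k ^ 2) / (1 - (1 / 2) ^ s), min ε₀ (min 1 ε₂),
    div_pos (by positivity) (by linarith), by positivity, ?_⟩
  intro ℋ _ _ _
  refine exists_monoidHom_of_halving (by linarith) fun f ε hε hf1 hf => ?_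
  obtain ⟨hεε₀, hε1, hεε₂⟩ : ε ≤ ε₀ ∧ ε ≤ 1 ∧ ε ≤ ε₂ := by simpa using hε
  have hε0 : 0 ≤ ε := (norm_nonneg _).trans (hf 1 1)
  obtain ⟨ρ, hρ⟩ := hH ℋ (fun y => f (1, y)) ε hεε₀ hf1
    (fun x y => by simpa using hf (1, x) (1, y))
  have hεs : ε ≤ ε ^ s := by
    simpa using Real.rpow_le_rpow_of_exponent_ge_of_imp hε0 hε1 hs1 (by grind)
  have hρ' : ∀ y, ‖(f (1, y) : ℋ →L[ℂ] ℋ) - ρ y‖ ≤ k * ε ^ s - 2 * ε := fun y =>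
    (hρ y).trans (by rw [hk]; linarith)
  have hsq : 8 * (k * ε ^ s) ^ 2 ≤ ε / 2 := by
    have h : (ε ^ s) ^ 2 = ε ^ (2 * s - 1) * ε := by
      rw [← Real.rpow_natCast, ← Real.rpow_mul hε0]
      nth_rewrite 3 [← Real.rpow_one ε]
      rw [← Real.rpow_add' hε0 (by linarith)]
      congr 1
      push_cast
      ring
    calc 8 * (k * ε ^ s) ^ 2 = 8 * k ^ 2 * ε ^ (2 * s - 1) * ε := by rw [mul_pow, h]; ring
      _ ≤ 8 * k ^ 2 * (1 / (16 * k ^ 2)) * ε := by gcongr; exact hsmall ε hε0 hεε₂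
      _ = ε / 2 := by field_simp; ring
  obtain ⟨f', h1, h2, h3⟩ := exists_quadratic_correction m f hf ρ hρ'
    (by rw [sub_add_cancel]; linarith)
  rw [sub_add_cancel] at h2 h3
  refine ⟨f', h1, fun a b => (h2 a b).trans hsq, fun a => (h3 a).trans ?_⟩
  have hs0 : 0 ≤ ε ^ s := Real.rpow_nonneg hε0 s
  have hs1' : ε ^ s ≤ 1 := Real.rpow_le_one hε0 hε1 (by linarith)
  calc k * ε ^ s + 2 * (k * ε ^ s) ^ 2 = (k + 2 * k ^ 2 * ε ^ s) * ε ^ s := by ring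
    _ ≤ (k + 2 * k ^ 2 * 1) * ε ^ s := by gcongr
    _ = (k + 2 * k ^ 2) * ε ^ s := by ring
end

section
/- Let G and H be groups, let a : H → Aut(G) be a group homomorphism, and let Q = G ⋊_a H be the associated semidirect product. Suppose: (i) G admits an invariant mean that is in addition invariant under inversion (m(x ↦ φ(x⁻¹)) = m(φ)); (ii) the image subgroup a(H) of Aut(G) admits an invariant mean; (iii) there exist constants c ≥ 1, ε₀ > 0, and 1/2 < s ≤ 1 such that for every complex Hilbert space ℋ and every map f : H → U(ℋ) with f(1) = 1 and δ(f) ≤ ε for some ε ≤ ε₀, there exists a group homomorphism ρ : H → U(ℋ) with sup_{x∈H} ‖f(x) − ρ(x)‖ ≤ c·ε^s. Then Q is strongly Ulam stable: for every η > 0 there exists ε > 0 such that for every complex Hilbert space ℋ and every map f : Q → U(ℋ) with f(1) = 1 and δ(f) ≤ ε, there exists a group homomorphism ρ : Q → U(ℋ) with sup_{q∈Q} ‖f(q) − ρ(q)‖ ≤ η. -/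
theorem abs_inv_sqrt_sub_one_le {t : ℝ} (ht : |t - 1| ≤ 1 / 2) : |(√t)⁻¹ - 1| ≤ |t - 1| := by
  obtain ⟨h₁, h₂⟩ := abs_le.mp ht
  have hr : 0 < √t := Real.sqrt_pos.mpr (by linarith)
  have hrr : √t * √t = t := Real.mul_self_sqrt (by linarith)
  have hprod : √t * (√t + 1) ≥ 1 := by nlinarith
  have h₃ : |(√t)⁻¹ - 1| = |√t - 1| / √t := by
    rw [show (√t)⁻¹ - 1 = -(√t - 1) / √t by field_simp; ring, abs_div, abs_neg, abs_of_pos hr]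
  have h₄ : |t - 1| = |√t - 1| * (√t + 1) := by
    rw [show t - 1 = (√t - 1) * (√t + 1) by linear_combination -hrr, abs_mul,
      abs_of_pos (show 0 < √t + 1 by linarith)]
  rw [h₃, h₄, div_le_iff₀ hr, mul_assoc, mul_comm (√t + 1)]
  exact le_mul_of_one_le_right (abs_nonneg _) hprod

/-- A self-adjoint element close to `1` has an inverse square root close to `1`. -/
theorem exists_inv_sqrt_near_one {A : Type*} [CStarAlgebra A] {Z : A} (hZ : IsSelfAdjoint Z)
    (hZ₁ : ‖Z - 1‖ ≤ 1 / 2) :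
    ∃ R : A, star R = R ∧ R * Z * R = 1 ∧ ‖R - 1‖ ≤ ‖Z - 1‖ ∧
      ∀ B : A, Commute Z B → Commute R B := by
  have hone : cfc (fun _ : ℝ => (1 : ℝ)) Z = 1 := cfc_const_one ℝ Z
  have hid : cfc (fun x : ℝ => x) Z = Z := cfc_id' ℝ Z
  have hspec : ∀ t ∈ spectrum ℝ Z, |t - 1| ≤ ‖Z - 1‖ := by
    intro t ht
    have h := norm_apply_le_norm_cfc (fun x : ℝ => x - 1) Z ht
    rwa [cfc_sub (fun x : ℝ => x) (fun _ => 1) Z, hid, hone] at h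
  have hpos : ∀ t ∈ spectrum ℝ Z, 0 < t := fun t ht => by
    linarith [(abs_le.mp ((hspec t ht).trans hZ₁)).1]
  have hcont : ContinuousOn (fun t : ℝ => (√t)⁻¹) (spectrum ℝ Z) :=
    Real.continuous_sqrt.continuousOn.inv₀ fun t ht => (Real.sqrt_pos.mpr (hpos t ht)).ne'
  refine ⟨cfc (fun t : ℝ => (√t)⁻¹) Z,
    cfc_predicate (p := IsSelfAdjoint) (fun t : ℝ => (√t)⁻¹) Z, ?_, ?_,
    fun B hB => hB.cfc_real _⟩
  · have h₁ := cfc_mul (fun t : ℝ => (√t)⁻¹) (fun t => t) Z hcont continuousOn_id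
    have h₂ := cfc_mul (fun t : ℝ => (√t)⁻¹ * t) (fun t => (√t)⁻¹) Z
      (hcont.mul continuousOn_id) hcont
    rw [h₁, hid] at h₂
    rw [← h₂, ← hone]
    refine cfc_congr fun t ht => ?_
    have hr := Real.sqrt_pos.mpr (hpos t ht)
    have hrr := Real.mul_self_sqrt (hpos t ht).le
    field_simp
    linarith
  · have h₁ := cfc_sub (fun t : ℝ => (√t)⁻¹) (fun _ => 1) Z hcont continuousOn_const
    rw [hone] at h₁
    rw [← h₁]
    exact norm_cfc_le (norm_nonneg _) fun t ht =>
      (abs_inv_sqrt_sub_one_le ((hspec t ht).trans hZ₁)).trans (hspec t ht)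

/-- The unitary part of an invertible contraction `M` with `M* M` close to `1`. It intertwines the
same unitaries as `M`. -/
theorem exists_unitary_near {A : Type*} [CStarAlgebra A] {M : A} (hM : IsUnit M)
    (hM₁ : ‖M‖ ≤ 1) (hMM : ‖star M * M - 1‖ ≤ 1 / 2) :
    ∃ U : unitary A, ‖(U : A) - M‖ ≤ ‖star M * M - 1‖ ∧
      ∀ B C : unitary A, M * B = C * M → (U : A) * B = C * U := by
  obtain ⟨R, hRs, hRZR, hR₁, hRc⟩ := exists_inv_sqrt_near_one (IsSelfAdjoint.star_mul_self M) hMM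
  have hUU : star (M * R) * (M * R) = 1 := by
    rw [star_mul, hRs, ← hRZR]
    noncomm_ring
  have hRu : IsUnit R := by
    have hcomm : R * (star M * M) = star M * M * R := hRc _ (Commute.refl _)
    exact ⟨⟨R, star M * M * R, by rw [← mul_assoc, hRZR], by rw [← hcomm, hRZR]⟩, rfl⟩
  have hUU' : M * R * star (M * R) = 1 := by
    obtain ⟨u, hu⟩ := hM.mul hRu
    rw [← hu] at hUU ⊢
    rw [Units.eq_inv_of_mul_eq_one_right hUU, Units.mul_inv]
  refine ⟨⟨M * R, hUU, hUU'⟩, ?_, fun B C hBC => ?_⟩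
  · calc ‖M * R - M‖ = ‖M * (R - 1)‖ := by rw [mul_sub, mul_one]
      _ ≤ 1 * ‖R - 1‖ := (norm_mul_le _ _).trans (by gcongr)
      _ ≤ ‖star M * M - 1‖ := by rwa [one_mul]
  · have h : star M * C = B * star M := by
      have := congrArg (fun x => (B : A) * star x * C) hBC
      simp only [star_mul, mul_assoc, Unitary.coe_star_mul_self, mul_one] at this
      rw [← mul_assoc, ← mul_assoc, Unitary.mul_star_self_of_mem B.2, one_mul] at this
      exact this
    have hcomm : Commute (star M * M) (B : A) := by
      change star M * M * B = B * (star M * M)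
      rw [mul_assoc, hBC, ← mul_assoc, h, mul_assoc]
    change M * R * B = C * (M * R)
    rw [mul_assoc, (hRc _ hcomm).eq, ← mul_assoc, hBC, mul_assoc]

section Means

variable {X : Type*} (μ : Mean X)

theorem IsBddR.add {φ ψ : X → ℝ} (hφ : IsBddR φ) (hψ : IsBddR ψ) :
    IsBddR (fun x => φ x + ψ x) := by
  obtain ⟨C, hC⟩ := hφ
  obtain ⟨D, hD⟩ := hψ
  exact ⟨C + D, fun x => (abs_add_le _ _).trans (add_le_add (hC x) (hD x))⟩

theorem IsBddR.const_mul {φ : X → ℝ} (hφ : IsBddR φ) (r : ℝ) : IsBddR (fun x => r * φ x) := by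
  obtain ⟨C, hC⟩ := hφ
  exact ⟨|r| * C, fun x => by rw [abs_mul]; exact mul_le_mul_of_nonneg_left (hC x) (abs_nonneg r)⟩

theorem isBddR_const (r : ℝ) : IsBddR (fun _ : X => r) := ⟨|r|, fun _ => le_rfl⟩

theorem Mean.app_const_s2 (r : ℝ) : μ.app (fun _ => r) = r := by
  simpa [μ.app_one] using μ.app_smul r (fun _ => 1) (isBddR_const 1)

theorem Mean.app_sub {φ ψ : X → ℝ} (hφ : IsBddR φ) (hψ : IsBddR ψ) :
    μ.app (fun x => φ x - ψ x) = μ.app φ - μ.app ψ := by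
  have h := μ.app_add φ (fun x => -1 * ψ x) hφ (hψ.const_mul _)
  rw [μ.app_smul _ _ hψ] at h
  simpa [sub_eq_add_neg] using h

theorem IsBddR.sub {φ ψ : X → ℝ} (hφ : IsBddR φ) (hψ : IsBddR ψ) :
    IsBddR (fun x => φ x - ψ x) := by
  simpa [sub_eq_add_neg] using hφ.add (hψ.const_mul (-1))

theorem Mean.app_le {φ : X → ℝ} {C : ℝ} (hφ : IsBddR φ) (h : ∀ x, φ x ≤ C) : μ.app φ ≤ C := by
  have := μ.app_nonneg (fun x => C - φ x) ((isBddR_const C).sub hφ) fun x => sub_nonneg.mpr (h x)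
  rw [μ.app_sub (isBddR_const C) hφ, μ.app_const_s2] at this
  linarith

theorem Mean.abs_app_le {φ : X → ℝ} {C : ℝ} (h : ∀ x, |φ x| ≤ C) : |μ.app φ| ≤ C := by
  have hφ : IsBddR φ := ⟨C, h⟩
  refine abs_le.mpr ⟨?_, μ.app_le hφ fun x => (abs_le.mp (h x)).2⟩
  have := μ.app_le (hφ.const_mul (-1)) fun x => show -1 * φ x ≤ C by linarith [(abs_le.mp (h x)).1]
  rw [μ.app_smul _ _ hφ] at this
  linarith

end Means

section OperatorAverages

variable {X : Type*} {μ : Mean X} {ℋ : Type*} [NormedAddCommGroup ℋ] [InnerProductSpace ℂ ℋ]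

/-- An operator-valued function is bounded. -/
def IsBddOp (F : X → ℋ →L[ℂ] ℋ) : Prop := ∃ C, ∀ x, ‖F x‖ ≤ C

/-- `T` is the weak average of the operator-valued function `F` with respect to the mean `μ`. -/
def IsAverage (μ : Mean X) (F : X → ℋ →L[ℂ] ℋ) (T : ℋ →L[ℂ] ℋ) : Prop :=
  ∀ v w : ℋ, (inner ℂ v (T w)).re = μ.app fun x => (inner ℂ v (F x w)).re

theorem abs_re_inner_apply_le {C : ℝ} {T : ℋ →L[ℂ] ℋ} (hT : ‖T‖ ≤ C) (v w : ℋ) :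
    |(inner ℂ v (T w)).re| ≤ C * ‖w‖ * ‖v‖ :=
  calc |(inner ℂ v (T w)).re| ≤ ‖inner ℂ v (T w)‖ := Complex.abs_re_le_norm _
    _ ≤ ‖v‖ * ‖T w‖ := norm_inner_le_norm _ _
    _ ≤ ‖v‖ * (C * ‖w‖) := by gcongr; exact T.le_of_opNorm_le hT w
    _ = C * ‖w‖ * ‖v‖ := by ring

theorem ext_re_inner {x y : ℋ} (h : ∀ v : ℋ, (inner ℂ v x).re = (inner ℂ v y).re) : x = y := by
  have := h (x - y)
  rw [← sub_eq_zero, ← Complex.sub_re, ← inner_sub_right] at this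
  rw [← sub_eq_zero, ← inner_self_eq_zero (𝕜 := ℂ)]
  exact Complex.ext this (inner_self_im (𝕜 := ℂ) (x - y))

theorem norm_le_of_re_inner_self_le {y : ℋ} {D : ℝ} (hD : 0 ≤ D)
    (h : |(inner ℂ y y).re| ≤ D * ‖y‖) : ‖y‖ ≤ D := by
  have h₁ : (inner ℂ y y).re = ‖y‖ * ‖y‖ := inner_self_eq_norm_mul_norm (𝕜 := ℂ) y
  rcases (norm_nonneg y).eq_or_lt' with h₀ | h₀
  · rwa [h₀]
  · exact le_of_mul_le_mul_right (h₁ ▸ (le_abs_self _).trans h) h₀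

theorem IsBddOp.isBddR {F : X → ℋ →L[ℂ] ℋ} (hF : IsBddOp F) (v w : ℋ) :
    IsBddR fun x => (inner ℂ v (F x w)).re := by
  obtain ⟨C, hC⟩ := hF
  exact ⟨_, fun x => abs_re_inner_apply_le (hC x) v w⟩

/-- Every bounded operator-valued function has a weak average. -/
theorem IsBddOp.exists_isAverage [CompleteSpace ℋ] {F : X → ℋ →L[ℂ] ℋ} (hF : IsBddOp F)
    (μ : Mean X) : ∃ T, IsAverage μ F T := by
  let : InnerProductSpace ℝ ℋ := InnerProductSpace.rclikeToReal ℂ ℋ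
  have hb := hF.isBddR
  obtain ⟨C, hC₀, hC⟩ : ∃ C, 0 ≤ C ∧ ∀ x, ‖F x‖ ≤ C :=
    hF.imp' (fun C => |C|) fun C h => ⟨abs_nonneg C, fun x => (h x).trans (le_abs_self C)⟩
  have hriesz : ∀ w : ℋ, ∃ y : ℋ, ∀ v : ℋ,
      (inner ℂ v y).re = μ.app fun x => (inner ℂ v (F x w)).re := by
    intro w
    let L : ℋ →ₗ[ℝ] ℝ :=
      { toFun := fun v => μ.app fun x => (inner ℂ v (F x w)).re
        map_add' := fun v v' => by
          simp only [inner_add_left, Complex.add_re]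
          exact μ.app_add _ _ (hb v w) (hb v' w)
        map_smul' := fun r v => by
          have h : ∀ z : ℋ, (inner ℂ (r • v) z).re = r * (inner ℂ v z).re := fun z => by
            rw [RCLike.real_smul_eq_coe_smul (K := ℂ), inner_smul_left]; simp
          simp only [h]
          exact μ.app_smul r _ (hb v w) }
    let L' : StrongDual ℝ ℋ := L.mkContinuous (C * ‖w‖) fun v =>
      μ.abs_app_le fun x => abs_re_inner_apply_le (hC x) v w
    refine ⟨(InnerProductSpace.toDual ℝ ℋ).symm L', fun v => ?_⟩
    have h := InnerProductSpace.toDual_symm_apply (𝕜 := ℝ) (x := v) (y := L')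
    rw [real_inner_comm, real_inner_eq_re_inner ℂ] at h
    exact h
  choose T hT using hriesz
  let T₀ : ℋ →ₗ[ℂ] ℋ :=
    { toFun := T
      map_add' := fun w w' => ext_re_inner fun v => by
        rw [inner_add_right, Complex.add_re, hT, hT, hT, ← μ.app_add _ _ (hb v w) (hb v w')]
        simp only [map_add, inner_add_right, Complex.add_re]
      map_smul' := fun z w => ext_re_inner fun v => by
        have h : ∀ y : ℋ, inner ℂ v (z • y) = inner ℂ ((starRingEnd ℂ) z • v) y := fun y => by
          rw [inner_smul_right, inner_smul_left, Complex.conj_conj]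
        simp only [RingHom.id_apply, h, hT, map_smul] }
  have hT₀ : ∀ w, ‖T₀ w‖ ≤ C * ‖w‖ := by
    intro w
    refine norm_le_of_re_inner_self_le (mul_nonneg hC₀ (norm_nonneg w)) ?_
    change |(inner ℂ (T w) (T w)).re| ≤ C * ‖w‖ * ‖T w‖
    rw [hT]
    exact μ.abs_app_le fun x => abs_re_inner_apply_le (hC x) (T w) w
  exact ⟨T₀.mkContinuous C hT₀, fun v w => hT w v⟩

theorem IsAverage.unique {F : X → ℋ →L[ℂ] ℋ} {S T : ℋ →L[ℂ] ℋ} (hS : IsAverage μ F S)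
    (hT : IsAverage μ F T) : S = T :=
  ContinuousLinearMap.ext fun w => ext_re_inner fun v => (hS v w).trans (hT v w).symm

theorem IsAverage.norm_le {F : X → ℋ →L[ℂ] ℋ} {T : ℋ →L[ℂ] ℋ} (hT : IsAverage μ F T) {C : ℝ}
    (hC : 0 ≤ C) (hF : ∀ x, ‖F x‖ ≤ C) : ‖T‖ ≤ C := by
  refine T.opNorm_le_bound hC fun w => ?_
  refine norm_le_of_re_inner_self_le (mul_nonneg hC (norm_nonneg w)) ?_
  rw [hT]
  exact μ.abs_app_le fun x => abs_re_inner_apply_le (hF x) _ w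

theorem isAverage_const (T : ℋ →L[ℂ] ℋ) : IsAverage μ (fun _ => T) T := fun _ _ =>
  (μ.app_const_s2 _).symm

theorem IsBddOp.sub {F F' : X → ℋ →L[ℂ] ℋ} (hF : IsBddOp F) (hF' : IsBddOp F') :
    IsBddOp fun x => F x - F' x := by
  obtain ⟨C, hC⟩ := hF
  obtain ⟨D, hD⟩ := hF'
  exact ⟨C + D, fun x => (norm_sub_le _ _).trans (add_le_add (hC x) (hD x))⟩

theorem IsBddOp.mul {F F' : X → ℋ →L[ℂ] ℋ} (hF : IsBddOp F) (hF' : IsBddOp F') :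
    IsBddOp fun x => F x * F' x := by
  obtain ⟨C, hC⟩ := hF
  obtain ⟨D, hD⟩ := hF'
  exact ⟨C * D, fun x => (norm_mul_le _ _).trans
    (mul_le_mul (hC x) (hD x) (norm_nonneg _) ((norm_nonneg _).trans (hC x)))⟩

theorem isBddOp_const (T : ℋ →L[ℂ] ℋ) : IsBddOp fun _ : X => T := ⟨_, fun _ => le_rfl⟩

theorem IsAverage.sub {F F' : X → ℋ →L[ℂ] ℋ} {T T' : ℋ →L[ℂ] ℋ} (hT : IsAverage μ F T)
    (hT' : IsAverage μ F' T') (hF : IsBddOp F) (hF' : IsBddOp F') :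
    IsAverage μ (fun x => F x - F' x) (T - T') := fun v w => by
  simp only [sub_apply, inner_sub_right, Complex.sub_re]
  rw [hT v w, hT' v w, μ.app_sub (hF.isBddR v w) (hF'.isBddR v w)]

theorem IsAverage.mul_const {F : X → ℋ →L[ℂ] ℋ} {T : ℋ →L[ℂ] ℋ} (hT : IsAverage μ F T)
    (A : ℋ →L[ℂ] ℋ) : IsAverage μ (fun x => F x * A) (T * A) := fun v w => hT v (A w)

variable [CompleteSpace ℋ]

theorem IsAverage.const_mul {F : X → ℋ →L[ℂ] ℋ} {T : ℋ →L[ℂ] ℋ} (hT : IsAverage μ F T)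
    (A : ℋ →L[ℂ] ℋ) : IsAverage μ (fun x => A * F x) (A * T) := fun v w => by
  simpa [ContinuousLinearMap.adjoint_inner_left] using hT (ContinuousLinearMap.adjoint A v) w

theorem IsAverage.adjoint {F : X → ℋ →L[ℂ] ℋ} {T : ℋ →L[ℂ] ℋ} (hT : IsAverage μ F T) :
    IsAverage μ (fun x => star (F x)) (star T) := fun v w => by
  have h : ∀ S : ℋ →L[ℂ] ℋ, (inner ℂ v (star S w)).re = (inner ℂ w (S v)).re := fun S => by
    rw [ContinuousLinearMap.star_eq_adjoint, ContinuousLinearMap.adjoint_inner_right]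
    exact inner_re_symm (𝕜 := ℂ) (S v) w
  simp only [h]
  exact hT w v

/-- Averages of functions close to constants are multiplicative up to a quadratic error. -/
theorem IsAverage.norm_sub_mul_le {F F' : X → ℋ →L[ℂ] ℋ} {S T T' u u' : ℋ →L[ℂ] ℋ} {δ : ℝ}
    (hS : IsAverage μ (fun x => F x * F' x) S) (hT : IsAverage μ F T) (hT' : IsAverage μ F' T')
    (hF : IsBddOp F) (hF' : IsBddOp F') (hδ : 0 ≤ δ) (hu : ∀ x, ‖F x - u‖ ≤ δ)
    (hu' : ∀ x, ‖F' x - u'‖ ≤ δ) : ‖S - T * T'‖ ≤ 2 * δ ^ 2 := by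
  have hcov : IsAverage μ (fun x => (F x - u) * (F' x - u')) (S - u * T' - (T - u) * u') := by
    have h := (hS.sub (hT'.const_mul u) (hF.mul hF') ((isBddOp_const u).mul hF')).sub
      ((hT.sub (isAverage_const u) hF (isBddOp_const u)).mul_const u')
      ((hF.mul hF').sub ((isBddOp_const u).mul hF'))
      ((hF.sub (isBddOp_const u)).mul (isBddOp_const u'))
    convert! h using 2 with x
    noncomm_ring
  have h₁ : ‖S - u * T' - (T - u) * u'‖ ≤ δ * δ :=
    hcov.norm_le (mul_nonneg hδ hδ) fun x => (norm_mul_le _ _).trans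
      (mul_le_mul (hu x) (hu' x) (norm_nonneg _) hδ)
  have h₂ : ‖T - u‖ ≤ δ := (hT.sub (isAverage_const u) hF (isBddOp_const u)).norm_le hδ hu
  have h₃ : ‖T' - u'‖ ≤ δ := (hT'.sub (isAverage_const u') hF' (isBddOp_const u')).norm_le hδ hu'
  calc ‖S - T * T'‖ = ‖S - u * T' - (T - u) * u' - (T - u) * (T' - u')‖ := by
        congr 1; noncomm_ring
    _ ≤ δ * δ + δ * δ := (norm_sub_le _ _).trans (add_le_add h₁ ((norm_mul_le _ _).trans
        (mul_le_mul h₂ h₃ (norm_nonneg _) hδ)))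
    _ = 2 * δ ^ 2 := by ring

end OperatorAverages

section UnitaryDistance

theorem norm_mul_sub_mul_le {A : Type*} [NormedRing A] (a b c d : A) :
    ‖a * b - c * d‖ ≤ ‖a - c‖ * ‖b‖ + ‖c‖ * ‖b - d‖ := by
  rw [show a * b - c * d = (a - c) * b + c * (b - d) by noncomm_ring]
  exact (norm_add_le _ _).trans (add_le_add (norm_mul_le _ _) (norm_mul_le _ _))

variable {A : Type*} [CStarAlgebra A]

theorem unitary_dist_eq (U V : unitary A) : dist U V = ‖(U : A) - V‖ := by
  rw [Subtype.dist_eq, dist_eq_norm]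

theorem unitary_dist_mul_left (W U V : unitary A) : dist (W * U) (W * V) = dist U V := by
  rw [unitary_dist_eq, unitary_dist_eq, Submonoid.coe_mul, Submonoid.coe_mul, ← mul_sub,
    CStarRing.norm_coe_unitary_mul]

theorem unitary_dist_mul_right (U V W : unitary A) : dist (U * W) (V * W) = dist U V := by
  rw [unitary_dist_eq, unitary_dist_eq, Submonoid.coe_mul, Submonoid.coe_mul, ← sub_mul,
    CStarRing.norm_mul_coe_unitary]

theorem unitary_dist_mul_mul_le (U V U' V' : unitary A) :
    dist (U * V) (U' * V') ≤ dist U U' + dist V V' := by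
  refine (dist_triangle _ (U' * V) _).trans ?_
  rw [unitary_dist_mul_right, unitary_dist_mul_left]

theorem norm_unitary_le_one (U : unitary A) : ‖(U : A)‖ ≤ 1 := by
  rcases subsingleton_or_nontrivial A with h | h
  · rw [Subsingleton.elim (U : A) 0, norm_zero]; exact zero_le_one
  · exact (CStarRing.norm_coe_unitary U).le

theorem isUnit_of_norm_sub_unitary_lt {M : A} {U : unitary A} (h : ‖M - U‖ < 1) : IsUnit M := by
  have h₁ : ‖1 - star (U : A) * M‖ < 1 := by
    rw [← Unitary.star_mul_self_of_mem U.2, ← mul_sub,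
      CStarRing.norm_mem_unitary_mul _ (Unitary.star_mem U.2), norm_sub_rev]
    exact h
  have h₂ := (Units.oneSub _ h₁).isUnit
  rw [Units.val_oneSub, sub_sub_cancel] at h₂
  have h₃ := (Unitary.toUnits U).isUnit.mul h₂
  rwa [Unitary.val_toUnits_apply, ← mul_assoc, Unitary.mul_star_self_of_mem U.2, one_mul] at h₃

end UnitaryDistance

section UnitaryAverages

variable {X : Type*} {μ : Mean X} {ℋ : Type*} [NormedAddCommGroup ℋ] [InnerProductSpace ℂ ℋ]

/-- The map `σ` preserves the mean `μ`. -/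
def Mean.Preserved (μ : Mean X) (σ : X → X) : Prop :=
  ∀ φ : X → ℝ, IsBddR φ → μ.app (fun x => φ (σ x)) = μ.app φ

theorem IsAverage.comp {F : X → ℋ →L[ℂ] ℋ} {T : ℋ →L[ℂ] ℋ} (hT : IsAverage μ F T)
    (hF : IsBddOp F) {σ : X → X} (hσ : μ.Preserved σ) : IsAverage μ (fun x => F (σ x)) T :=
  fun v w => (hT v w).trans (hσ _ (hF.isBddR v w)).symm

variable [CompleteSpace ℋ]

theorem isBddOp_unitary (F : X → unitary (ℋ →L[ℂ] ℋ)) :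
    IsBddOp fun x => (F x : ℋ →L[ℂ] ℋ) := ⟨1, fun x => norm_unitary_le_one (F x)⟩

/-- The unitary part of the average of a unitary-valued function close to a constant. -/
theorem exists_unitary_near_average (μ : Mean X) (F : X → unitary (ℋ →L[ℂ] ℋ))
    (u : unitary (ℋ →L[ℂ] ℋ)) {δ : ℝ} (hδ₀ : 0 ≤ δ) (hδ : δ ≤ 1 / 4)
    (hF : ∀ x, dist (F x) u ≤ δ) :
    ∃ (T : ℋ →L[ℂ] ℋ) (U : unitary (ℋ →L[ℂ] ℋ)), IsAverage μ (fun x => (F x : ℋ →L[ℂ] ℋ)) T ∧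
      ‖(U : ℋ →L[ℂ] ℋ) - T‖ ≤ 2 * δ ^ 2 ∧ dist U u ≤ 2 * δ ∧
      ((∀ x, F x = 1) → U = 1) ∧
      ∀ (B C : unitary (ℋ →L[ℂ] ℋ)) (σ : X → X), μ.Preserved σ →
        (∀ x, F x * B = C * F (σ x)) → U * B = C * U := by
  have hb := isBddOp_unitary F
  have hb' : IsBddOp fun x => star (F x : ℋ →L[ℂ] ℋ) := isBddOp_unitary fun x => star (F x)
  obtain ⟨T, hT⟩ := hb.exists_isAverage μ
  have hFu : ∀ x, ‖(F x : ℋ →L[ℂ] ℋ) - u‖ ≤ δ := fun x => unitary_dist_eq (F x) u ▸ hF x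
  have hTu : ‖T - u‖ ≤ δ :=
    (hT.sub (isAverage_const _) hb (isBddOp_const _)).norm_le hδ₀ hFu
  have hT₁ : ‖T‖ ≤ 1 := hT.norm_le zero_le_one fun x => norm_unitary_le_one (F x)
  have hone : IsAverage μ (fun x => star (F x : ℋ →L[ℂ] ℋ) * (F x : ℋ →L[ℂ] ℋ)) 1 := by
    simp only [Unitary.coe_star_mul_self]
    exact isAverage_const 1
  have hTT : ‖star T * T - 1‖ ≤ 2 * δ ^ 2 := by
    rw [norm_sub_rev]
    refine hone.norm_sub_mul_le hT.adjoint hT hb' hb hδ₀ (u := star (u : ℋ →L[ℂ] ℋ))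
      (fun x => ?_) hFu
    rw [← star_sub, norm_star]
    exact hFu x
  obtain ⟨U, hUT, hU⟩ := exists_unitary_near
    (isUnit_of_norm_sub_unitary_lt (hTu.trans_lt (by linarith))) hT₁ (hTT.trans (by nlinarith))
  refine ⟨T, U, hT, hUT.trans hTT, ?_, fun h => ?_, fun B C σ hσ h => ?_⟩
  · rw [unitary_dist_eq]
    have := norm_sub_le_norm_sub_add_norm_sub (U : ℋ →L[ℂ] ℋ) T u
    nlinarith
  · have hT' : T = 1 := hT.unique (by simpa only [h] using! isAverage_const _)
    rw [hT', star_one, one_mul, sub_self, norm_zero, norm_le_zero_iff, sub_eq_zero] at hUT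
    exact Subtype.ext hUT
  · refine Subtype.ext (hU B C ((hT.mul_const B).unique ?_))
    have h' : (fun x => (F x : ℋ →L[ℂ] ℋ) * B) = fun x => (C : ℋ →L[ℂ] ℋ) * F (σ x) :=
      funext fun x => congrArg Subtype.val (h x)
    rw [h']
    exact (hT.comp hb hσ).const_mul _

/-- Averaging a unitary cocycle close to a function `f` yields a map close to `f` whose defect is
quadratically small. -/
theorem exists_unitary_near_cocycle {Γ : Type*} [Group Γ] (μ : Mean X) (act : Γ → X → X)
    (hact : ∀ γ, μ.Preserved (act γ)) (F : Γ → X → unitary (ℋ →L[ℂ] ℋ))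
    (f : Γ → unitary (ℋ →L[ℂ] ℋ)) {δ : ℝ} (hδ₀ : 0 ≤ δ) (hδ : δ ≤ 1 / 4)
    (hF₁ : ∀ x, F 1 x = 1) (hF : ∀ γ γ' x, F (γ * γ') x = F γ (act γ' x) * F γ' x)
    (hFf : ∀ γ x, dist (F γ x) (f γ) ≤ δ) :
    ∃ f' : Γ → unitary (ℋ →L[ℂ] ℋ), f' 1 = 1 ∧ (∀ γ, dist (f' γ) (f γ) ≤ 2 * δ) ∧
      (∀ γ γ', dist (f' (γ * γ')) (f' γ * f' γ') ≤ 8 * δ ^ 2) ∧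
      ∀ (γ : Γ) (B C : unitary (ℋ →L[ℂ] ℋ)) (σ : X → X), μ.Preserved σ →
        (∀ x, F γ x * B = C * F γ (σ x)) → f' γ * B = C * f' γ := by
  choose T U hT hUT hUf hU₁ hU using fun γ =>
    exists_unitary_near_average μ (F γ) (f γ) hδ₀ hδ (hFf γ)
  have hb := fun γ => isBddOp_unitary (F γ)
  have hmul : ∀ γ γ', ‖T (γ * γ') - T γ * T γ'‖ ≤ 2 * δ ^ 2 := by
    intro γ γ'
    have hS := hT (γ * γ')
    simp only [hF, Submonoid.coe_mul] at hS
    exact hS.norm_sub_mul_le ((hT γ).comp (hb γ) (hact γ')) (hT γ')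
      (isBddOp_unitary fun x => F γ (act γ' x)) (hb γ') hδ₀
      (fun x => unitary_dist_eq (F γ (act γ' x)) (f γ) ▸ hFf γ _)
      (fun x => unitary_dist_eq (F γ' x) (f γ') ▸ hFf γ' x)
  refine ⟨U, hU₁ 1 hF₁, hUf, fun γ γ' => ?_, hU⟩
  have hT₁ : ‖T γ'‖ ≤ 1 := (hT γ').norm_le zero_le_one fun x => norm_unitary_le_one (F γ' x)
  have h₁ := norm_mul_sub_mul_le (T γ) (T γ') (U γ) (U γ')
  have h₁' : ‖T γ - U γ‖ * ‖T γ'‖ ≤ 2 * δ ^ 2 * 1 := by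
    rw [norm_sub_rev]
    exact mul_le_mul (hUT γ) hT₁ (norm_nonneg _) (by positivity)
  have h₁'' : ‖(U γ : ℋ →L[ℂ] ℋ)‖ * ‖T γ' - U γ'‖ ≤ 1 * (2 * δ ^ 2) := by
    rw [norm_sub_rev]
    exact mul_le_mul (norm_unitary_le_one _) (hUT γ') (norm_nonneg _) zero_le_one
  rw [unitary_dist_eq, Submonoid.coe_mul]
  have h₂ := norm_sub_le_norm_sub_add_norm_sub (U (γ * γ') : ℋ →L[ℂ] ℋ) (T (γ * γ'))
    (U γ * U γ' : ℋ →L[ℂ] ℋ)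
  have h₃ := norm_sub_le_norm_sub_add_norm_sub (T (γ * γ')) (T γ * T γ')
    (U γ * U γ' : ℋ →L[ℂ] ℋ)
  linarith [hUT (γ * γ'), hmul γ γ', sq_nonneg δ]

end UnitaryAverages

section Iteration

open Filter Topology

/-- Iterating an improvement step that halves the error produces a limit. -/
theorem exists_limit_of_halving {Γ E : Type*} [MetricSpace E] [CompleteSpace E]
    (P : ℝ → (Γ → E) → Prop) {K δ₀ : ℝ} (hδ₀ : 0 < δ₀)
    (step : ∀ δ f, 0 < δ → δ ≤ δ₀ → P δ f → ∃ f', P (δ / 2) f' ∧ ∀ x, dist (f x) (f' x) ≤ K * δ)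
    (f : Γ → E) (hf : P δ₀ f) :
    ∃ (F : ℕ → Γ → E) (L : Γ → E), (∀ n, P (δ₀ / 2 ^ n) (F n)) ∧
      (∀ x, Tendsto (fun n => F n x) atTop (𝓝 (L x))) ∧ ∀ x, dist (f x) (L x) ≤ 2 * K * δ₀ := by
  have hpos : ∀ n : ℕ, 0 < δ₀ / 2 ^ n := fun n => by positivity
  have hle : ∀ n : ℕ, δ₀ / 2 ^ n ≤ δ₀ := fun n => div_le_self hδ₀.le (one_le_pow₀ one_le_two)
  choose! next hnext hdist using step
  let F : ℕ → Γ → E := fun n => Nat.rec f (fun k g => next (δ₀ / 2 ^ k) g) n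
  have hP : ∀ n, P (δ₀ / 2 ^ n) (F n) := by
    intro n
    induction n with
    | zero => simpa [F] using hf
    | succ k ih =>
      rw [pow_succ, ← div_div]
      exact hnext _ _ (hpos k) (hle k) ih
  have hF : ∀ x n, dist (F n x) (F (n + 1) x) ≤ 2 * K * δ₀ / 2 / 2 ^ n := fun x n =>
    (hdist _ _ (hpos n) (hle n) (hP n) x).trans_eq (by ring)
  choose L hL using fun x => cauchySeq_tendsto_of_complete (cauchySeq_of_le_geometric_two (hF x))
  exact ⟨F, L, hP, hL, fun x => dist_le_of_le_geometric_two_of_tendsto₀ (hF x) (hL x)⟩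

theorem tendsto_div_two_pow (δ₀ : ℝ) : Tendsto (fun n : ℕ => δ₀ / 2 ^ n) atTop (𝓝 0) :=
  tendsto_const_nhds.div_atTop (tendsto_pow_atTop_atTop_of_one_lt one_lt_two)

theorem eq_of_tendsto_of_dist_le {E : Type*} [MetricSpace E] {u v : ℕ → E} {x y : E} {δ₀ : ℝ}
    (hu : Tendsto u atTop (𝓝 x)) (hv : Tendsto v atTop (𝓝 y))
    (h : ∀ n, dist (u n) (v n) ≤ δ₀ / 2 ^ n) : x = y :=
  dist_le_zero.mp (le_of_tendsto_of_tendsto' (hu.dist hv) (tendsto_div_two_pow δ₀) h)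

variable {ℋ : Type*} [NormedAddCommGroup ℋ] [InnerProductSpace ℂ ℋ] [CompleteSpace ℋ]

instance completeSpace_unitary {A : Type*} [CStarAlgebra A] : CompleteSpace (unitary A) :=
  (isClosed_unitary (R := A)).completeSpace_coe

/-- Almost representations of a group with a left-invariant mean are close to representations. -/
theorem exists_hom_near_of_mean {G : Type*} [Group G] (μ : Mean G)
    (hμ : ∀ g, μ.Preserved (g * ·)) (f : G → unitary (ℋ →L[ℂ] ℋ)) {δ : ℝ} (hδ₀ : 0 < δ)
    (hδ : δ ≤ 1 / 16) (hf₁ : f 1 = 1) (hf : ∀ x y, dist (f (x * y)) (f x * f y) ≤ δ) :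
    ∃ π : G →* unitary (ℋ →L[ℂ] ℋ), ∀ x, dist (f x) (π x) ≤ 4 * δ := by
  obtain ⟨F, L, hF, hL, hfL⟩ := exists_limit_of_halving
    (fun δ f => f 1 = 1 ∧ ∀ x y : G, dist (f (x * y)) (f x * f y) ≤ δ) (K := 2) hδ₀
    (fun δ' f hδ'₀ hδ' hf => by
      obtain ⟨f', hf'₁, hf'f, hf', -⟩ := exists_unitary_near_cocycle μ (fun g x => g * x) hμ
        (fun g x => f (g * x) * (f x)⁻¹) f hδ'₀.le (by linarith) (fun x => by simp)
        (fun g g' x => by simp [mul_assoc]) (fun g x => by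
          rw [← unitary_dist_mul_right _ _ (f x), inv_mul_cancel_right]
          exact hf.2 g x)
      refine ⟨f', ⟨hf'₁, fun x y => (hf' x y).trans (by nlinarith)⟩, fun x => ?_⟩
      rw [dist_comm]
      exact hf'f x) f ⟨hf₁, hf⟩
  refine ⟨MonoidHom.mk' L fun x y => ?_, fun x => (hfL x).trans_eq (by ring)⟩
  exact eq_of_tendsto_of_dist_le (hL (x * y)) ((hL x).mul (hL y)) fun n => (hF n).2 x y

/-- A representation of `H` that almost intertwines a representation `π` of `G` with its twists
is close to one that intertwines them exactly, provided that `H` is strongly Ulam stable with a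
modulus `ω` that is small compared to the square root. -/
theorem exists_intertwining_hom_near {G H : Type*} [Group G] [Group H] (a : H →* MulAut G)
    (μ : Mean G) (hμ : ∀ g, μ.Preserved (g * ·)) (hμa : ∀ h, μ.Preserved (a h))
    {ω : ℝ → ℝ} {δ₀ : ℝ} (hδ₀ : 0 < δ₀) (hδ₀' : δ₀ ≤ 1 / 4)
    (hω : ∀ δ, 0 < δ → δ ≤ δ₀ → 4 * ω (8 * δ ^ 2) ≤ δ)
    (hH : ∀ (f : H → unitary (ℋ →L[ℂ] ℋ)) (δ : ℝ), 0 < δ → δ ≤ δ₀ → f 1 = 1 →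
      (∀ x y, dist (f (x * y)) (f x * f y) ≤ 8 * δ ^ 2) →
      ∃ ρ : H →* unitary (ℋ →L[ℂ] ℋ), ∀ x, dist (f x) (ρ x) ≤ ω (8 * δ ^ 2))
    (π : G →* unitary (ℋ →L[ℂ] ℋ)) (ρ : H →* unitary (ℋ →L[ℂ] ℋ))
    (hρ : ∀ h g, dist (ρ h * π g) (π (a h g) * ρ h) ≤ δ₀) :
    ∃ ρ' : H →* unitary (ℋ →L[ℂ] ℋ), (∀ h g, ρ' h * π g = π (a h g) * ρ' h) ∧
      ∀ h, dist (ρ h) (ρ' h) ≤ 6 * δ₀ := by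
  have step : ∀ δ (f : H → unitary (ℋ →L[ℂ] ℋ)), 0 < δ → δ ≤ δ₀ →
      ((∃ ρ : H →* unitary (ℋ →L[ℂ] ℋ), ⇑ρ = f) ∧
        ∀ h g, dist (f h * π g) (π (a h g) * f h) ≤ δ) →
      ∃ f' : H → unitary (ℋ →L[ℂ] ℋ), ((∃ ρ : H →* unitary (ℋ →L[ℂ] ℋ), ⇑ρ = f') ∧
        ∀ h g, dist (f' h * π g) (π (a h g) * f' h) ≤ δ / 2) ∧ ∀ x, dist (f x) (f' x) ≤ 3 * δ := by
    rintro δ _ hδ hδδ₀ ⟨⟨ρ, rfl⟩, hρ⟩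
    obtain ⟨f', hf'₁, hf'ρ, hf', hint⟩ := exists_unitary_near_cocycle μ (fun h x => a h x) hμa
      (fun h x => π (a h x) * ρ h * (π x)⁻¹) ρ hδ.le (by linarith) (fun x => by simp)
      (fun h h' x => by simp [mul_assoc]) (fun h x => by
        rw [← unitary_dist_mul_right _ _ (π x), inv_mul_cancel_right, dist_comm]
        exact hρ h x)
    have hf'π : ∀ h g, f' h * π g = π (a h g) * f' h := fun h g =>
      hint h _ _ (g⁻¹ * ·) (hμ g⁻¹) fun x => by simp [mul_assoc]
    obtain ⟨ρ', hρ'⟩ := hH f' δ hδ hδδ₀ hf'₁ hf'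
    have hωδ := hω δ hδ hδδ₀
    refine ⟨ρ', ⟨⟨ρ', rfl⟩, fun h g => ?_⟩, fun h => ?_⟩
    · refine (dist_triangle _ (f' h * π g) _).trans ?_
      rw [unitary_dist_mul_right, hf'π, unitary_dist_mul_left, dist_comm]
      linarith [hρ' h]
    · refine (dist_triangle_left _ _ (f' h)).trans ?_
      linarith [hρ' h, hf'ρ h]
  obtain ⟨F, L, hF, hL, hρL⟩ := exists_limit_of_halving _ hδ₀ step ρ ⟨⟨ρ, rfl⟩, hρ⟩
  refine ⟨MonoidHom.mk' L fun x y => ?_, fun h g => ?_, fun x => (hρL x).trans_eq (by ring)⟩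
  · refine tendsto_nhds_unique (hL (x * y)) (((hL x).mul (hL y)).congr fun n => ?_)
    obtain ⟨ρ, hρ⟩ := (hF n).1
    rw [← hρ, map_mul]
  · exact eq_of_tendsto_of_dist_le ((hL h).mul_const (π g)) ((hL h).const_mul (π (a h g)))
      fun n => (hF n).2 h g

end Iteration

section Main

open Filter Topology

/-- Averaging a mean on `G` over a group of automorphisms. -/
theorem exists_mean_preserved_by_mul_and_aut {G : Type*} [Group G] (m : InvariantMean G)
    {A : Subgroup (MulAut G)} (mA : InvariantMean A) :
    ∃ μ : Mean G, (∀ g, μ.Preserved (g * ·)) ∧ ∀ α ∈ A, μ.Preserved α := by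
  have hb : ∀ {φ : G → ℝ}, IsBddR φ → ∀ α : MulAut G, IsBddR fun x => φ (α x) :=
    fun ⟨C, hC⟩ α => ⟨C, fun x => hC _⟩
  have hbA : ∀ {φ : G → ℝ}, IsBddR φ →
      IsBddR fun α : A => m.app fun x => φ ((α : MulAut G) x) :=
    fun ⟨C, hC⟩ => ⟨C, fun α => m.abs_app_le fun x => hC _⟩
  refine ⟨{
    app := fun φ => mA.app fun α => m.app fun x => φ ((α : MulAut G) x)
    app_add := fun φ ψ hφ hψ => ?_
    app_smul := fun r φ hφ => ?_
    app_nonneg := fun φ hφ h => ?_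
    app_one := ?_ }, fun g φ hφ => ?_, fun β hβ φ hφ => ?_⟩
  · rw [← mA.app_add _ _ (hbA hφ) (hbA hψ)]
    exact congrArg _ (funext fun α => m.app_add _ _ (hb hφ α) (hb hψ α))
  · rw [← mA.app_smul _ _ (hbA hφ)]
    exact congrArg _ (funext fun α => m.app_smul _ _ (hb hφ α))
  · exact mA.app_nonneg _ (hbA hφ) fun α => m.app_nonneg _ (hb hφ α) fun x => h _
  · simp only [m.app_one, mA.app_one]
  · refine congrArg mA.app (funext fun α => ?_)
    have h := m.app_left ((α : MulAut G)⁻¹ g) _ (hb hφ α)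
    simpa only [map_mul, MulAut.apply_inv_self] using h
  · exact mA.app_left ⟨β, hβ⟩ _ (hbA hφ)

theorem exists_forall_le_mul_rpow_sq_le {s : ℝ} (hs : 1 / 2 < s) (c : ℝ) :
    ∃ δ₀ > 0, ∀ δ, 0 < δ → δ ≤ δ₀ → 4 * (c * (8 * δ ^ 2) ^ s) ≤ δ := by
  have hlim : Tendsto (fun δ : ℝ => 4 * (c * (8 : ℝ) ^ s) * δ ^ (2 * s - 1)) (𝓝 0) (𝓝 0) := by
    have h := (Real.continuousAt_rpow_const 0 (2 * s - 1) (Or.inr (by linarith))).tendsto.const_mul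
      (4 * (c * (8 : ℝ) ^ s))
    rwa [Real.zero_rpow (by linarith), mul_zero] at h
  obtain ⟨r, hr, h⟩ := Metric.eventually_nhds_iff.mp (hlim.eventually_lt_const one_pos)
  refine ⟨r / 2, half_pos hr, fun δ hδ hδr => ?_⟩
  have h₁ := h (show dist δ 0 < r by rw [Real.dist_0_eq_abs, abs_of_pos hδ]; linarith)
  have h₂ : (8 * δ ^ 2) ^ s = 8 ^ s * (δ ^ (2 * s - 1) * δ) := by
    rw [Real.mul_rpow (by norm_num) (by positivity), ← Real.rpow_natCast δ 2, ← Real.rpow_mul hδ.le]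
    nth_rewrite 3 [← Real.rpow_one δ]
    rw [← Real.rpow_add hδ]
    norm_num
  rw [h₂]
  nlinarith

theorem exists_pos_linear_add_rpow_le {s : ℝ} (hs : 0 < s) (c : ℝ) {κ : ℝ} (hκ : 0 < κ) :
    ∃ ε > 0, ε ≤ κ ∧ 10 * ε + 2 * (c * ε ^ s) ≤ κ := by
  have hlim : Tendsto (fun ε : ℝ => 10 * ε + 2 * (c * ε ^ s)) (𝓝 0) (𝓝 0) := by
    have h := (tendsto_id.const_mul (10 : ℝ)).add
      (((Real.continuousAt_rpow_const 0 s (Or.inr hs.le)).tendsto.const_mul c).const_mul 2)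
    simpa [Real.zero_rpow hs.ne'] using h
  obtain ⟨r, hr, h⟩ := Metric.eventually_nhds_iff.mp (hlim.eventually_lt_const hκ)
  have hpos : 0 < min (r / 2) κ := lt_min (half_pos hr) hκ
  refine ⟨min (r / 2) κ, hpos, min_le_right _ _, (h ?_).le⟩
  rw [Real.dist_0_eq_abs, abs_of_pos hpos]
  linarith [min_le_left (r / 2) κ]

end Main

universe u

/-- Let `a : H →* MulAut G` and `Q = G ⋊[a] H`. If `G` admits an
invariant mean that is also invariant under inversion, the image `a(H) ≤ Aut(G)`
admits an invariant mean, and `H` is strongly Ulam stable with modulus `O(ε^s)`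
for some `1/2 < s ≤ 1`, then `Q` is strongly Ulam stable. -/
theorem semidirect_product_preservation (G H : Type*) [Group G] [Group H]
    (a : H →* MulAut G)
    (m : InvariantMean G)
    (minv : ∀ φ : G → ℝ, IsBddR φ → m.app (fun x => φ x⁻¹) = m.app φ)
    (mA : InvariantMean a.range)
    (c ε₀ s : ℝ) (hc : 1 ≤ c) (hε₀ : 0 < ε₀) (hs : 1 / 2 < s) (hs1 : s ≤ 1)
    (hH : ∀ (ℋ : Type u) [NormedAddCommGroup ℋ] [InnerProductSpace ℂ ℋ] [CompleteSpace ℋ]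
      (f : H → unitary (ℋ →L[ℂ] ℋ)) (ε : ℝ), ε ≤ ε₀ → f 1 = 1 →
      (∀ x y : H,
        ‖(f (x * y) : ℋ →L[ℂ] ℋ) - (f x : ℋ →L[ℂ] ℋ) * (f y : ℋ →L[ℂ] ℋ)‖ ≤ ε) →
      ∃ ρ : H →* unitary (ℋ →L[ℂ] ℋ),
        ∀ x : H, ‖(f x : ℋ →L[ℂ] ℋ) - (ρ x : ℋ →L[ℂ] ℋ)‖ ≤ c * ε ^ s) :
    ∀ η : ℝ, 0 < η → ∃ ε : ℝ, 0 < ε ∧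
      ∀ (ℋ : Type u) [NormedAddCommGroup ℋ] [InnerProductSpace ℂ ℋ] [CompleteSpace ℋ]
        (f : G ⋊[a] H → unitary (ℋ →L[ℂ] ℋ)), f 1 = 1 →
        (∀ p q : G ⋊[a] H,
          ‖(f (p * q) : ℋ →L[ℂ] ℋ) - (f p : ℋ →L[ℂ] ℋ) * (f q : ℋ →L[ℂ] ℋ)‖ ≤ ε) →
        ∃ ρ : G ⋊[a] H →* unitary (ℋ →L[ℂ] ℋ),
          ∀ q : G ⋊[a] H, ‖(f q : ℋ →L[ℂ] ℋ) - (ρ q : ℋ →L[ℂ] ℋ)‖ ≤ η := by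
  obtain ⟨μ, hμ, hμa⟩ := exists_mean_preserved_by_mul_and_aut m mA
  obtain ⟨δ₁, hδ₁, hω⟩ := exists_forall_le_mul_rpow_sq_le hs c
  intro η hη
  -- The thresholds needed for the iterations on `G` and on `H`.
  obtain ⟨κ, hκ, hκ₁, hκη, hκ₂, hκε₀⟩ :
      ∃ κ > 0, κ ≤ δ₁ ∧ κ ≤ η / 7 ∧ κ ≤ 1 / 16 ∧ κ ≤ ε₀ / 8 :=
    ⟨min (min δ₁ (η / 7)) (min (1 / 16) (ε₀ / 8)), by positivity, by simp, by simp, by simp,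
      by simp⟩
  obtain ⟨ε, hε, hεκ, hδκ⟩ := exists_pos_linear_add_rpow_le (by linarith : 0 < s) c hκ
  refine ⟨ε, hε, fun ℋ _ _ _ f hf₁ hf => ?_⟩
  replace hf : ∀ p q, dist (f (p * q)) (f p * f q) ≤ ε := fun p q => by
    rw [unitary_dist_eq]
    exact hf p q
  replace hH : ∀ (f : H → unitary (ℋ →L[ℂ] ℋ)) (ε : ℝ), ε ≤ ε₀ → f 1 = 1 →
      (∀ x y, dist (f (x * y)) (f x * f y) ≤ ε) →
      ∃ ρ : H →* unitary (ℋ →L[ℂ] ℋ), ∀ x, dist (f x) (ρ x) ≤ c * ε ^ s := fun f ε hε h₁ h => by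
    simp only [unitary_dist_eq] at h ⊢
    exact hH ℋ f ε hε h₁ h
  obtain ⟨π, hπ⟩ := exists_hom_near_of_mean μ hμ (fun g => f (SemidirectProduct.inl g)) hε
    (hεκ.trans hκ₂) (by simpa using hf₁) fun x y => by simpa using hf _ _
  obtain ⟨ρ, hρ⟩ := hH (fun h => f (SemidirectProduct.inr h)) ε (by linarith)
    (by simpa using hf₁) fun x y => by simpa using hf _ _
  have hρπ : ∀ h g, dist (ρ h * π g) (π (a h g) * ρ h) ≤ κ := by
    intro h g
    have h₁ := hf (SemidirectProduct.inr h) (SemidirectProduct.inl g)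
    have h₂ := hf (SemidirectProduct.inl (a h g)) (SemidirectProduct.inr h)
    have h₃ := unitary_dist_mul_mul_le (f (SemidirectProduct.inr h)) (f (SemidirectProduct.inl g))
      (ρ h) (π g)
    have h₄ := unitary_dist_mul_mul_le (f (SemidirectProduct.inl (a h g)))
      (f (SemidirectProduct.inr h)) (π (a h g)) (ρ h)
    rw [show (SemidirectProduct.inl (a h g) * SemidirectProduct.inr h : G ⋊[a] H) =
      SemidirectProduct.inr h * SemidirectProduct.inl g by
        rw [SemidirectProduct.inl_aut]; simp] at h₂
    have h₅ := dist_triangle4_right (ρ h * π g) (π (a h g) * ρ h)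
      (f (SemidirectProduct.inr h) * f (SemidirectProduct.inl g))
      (f (SemidirectProduct.inl (a h g)) * f (SemidirectProduct.inr h))
    have h₆ := dist_triangle_left (f (SemidirectProduct.inr h) * f (SemidirectProduct.inl g))
      (f (SemidirectProduct.inl (a h g)) * f (SemidirectProduct.inr h))
      (f (SemidirectProduct.inr h * SemidirectProduct.inl g))
    rw [dist_comm] at h₃ h₄
    linarith [hπ g, hρ h, hπ (a h g)]
  obtain ⟨ρ', hρ'π, hρ'⟩ := exists_intertwining_hom_near a μ hμ (fun h => hμa _ ⟨h, rfl⟩)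
    (ω := fun t => c * t ^ s) hκ (hκ₂.trans (by norm_num))
    (fun δ hδ hδκ => hω δ hδ (hδκ.trans hκ₁))
    (fun f' δ hδ hδκ => hH f' (8 * δ ^ 2) (by nlinarith)) π ρ hρπ
  refine ⟨SemidirectProduct.lift π ρ' fun h => ?_, fun q => ?_⟩
  · ext1 g
    have := hρ'π h g
    simp only [MonoidHom.comp_apply, MulEquiv.coe_toMonoidHom, MulAut.conj_apply]
    rw [this, mul_inv_cancel_right]
  · rw [← unitary_dist_eq, ← SemidirectProduct.inl_left_mul_inr_right q, map_mul,
      SemidirectProduct.lift_inl, SemidirectProduct.lift_inr]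
    have h₁ := hf (SemidirectProduct.inl q.left) (SemidirectProduct.inr q.right)
    have h₂ := unitary_dist_mul_mul_le (f (SemidirectProduct.inl q.left))
      (f (SemidirectProduct.inr q.right)) (π q.left) (ρ' q.right)
    have h₃ := dist_triangle (f (SemidirectProduct.inr q.right)) (ρ q.right) (ρ' q.right)
    have h₄ := dist_triangle (f (SemidirectProduct.inl q.left * SemidirectProduct.inr q.right))
      (f (SemidirectProduct.inl q.left) * f (SemidirectProduct.inr q.right))
      (π q.left * ρ' q.right)
    have h₅ : 0 ≤ c * ε ^ s := dist_nonneg.trans (hρ 1)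
    linarith [hπ q.left, hρ q.right, hρ' q.right]
end
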